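/- arXiv:1304.0733 — 2 statements merged into one kernel-verified Lean document; each statement's English description precedes it below -/
import Mathlib

section
/- For each n with 2 ≤ n ≤ 6, every R-trivial regular language L over a two-letter alphabet with sc(L) = n satisfies sc(L^R) ≤ 2^{n-2} + n - 1, and there exists a J-trivial (hence R-trivial) regular language L over a two-letter alphabet with sc(L) = n and sc(L^R) = 2^{n-2} + n - 1. -/
/-- A DFA is *partially ordered* if its reachability relation
`p ≼ q ↔ ∃ w, M.evalFrom p w = q` is antisymmetric (hence a partial order). -/
def DFA.PartiallyOrderedDFA {α σ : Type} (M : DFA α σ) : Prop :=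
  ∀ p q : σ, (∃ w : List α, M.evalFrom p w = q) → (∃ w : List α, M.evalFrom q w = p) → p = q

/-- A DFA is *minimal* if every state is reachable from the initial state and
all pairs of distinct states are distinguishable. -/
def DFA.MinimalDFA {α σ : Type} (M : DFA α σ) : Prop :=
  (∀ q : σ, ∃ w : List α, M.evalFrom M.start w = q) ∧
  (∀ p q : σ, p ≠ q →
    ∃ w : List α, ¬ (M.evalFrom p w ∈ M.accept ↔ M.evalFrom q w ∈ M.accept))

/-- The *state complexity* of a language: the least number of states of a
(complete, deterministic) finite automaton accepting it. -/
noncomputable def stateComplexity {α : Type} (L : Language α) : ℕ :=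
  sInf {n : ℕ | ∃ M : DFA α (Fin n), M.accepts = L}

/-- A regular language is *R-trivial* iff its minimal DFA is partially ordered. -/
def IsRTrivial {α : Type} (L : Language α) : Prop :=
  ∃ (n : ℕ) (M : DFA α (Fin n)), M.MinimalDFA ∧ M.accepts = L ∧ M.PartiallyOrderedDFA

/-- A regular language is *J-trivial* iff the minimal DFAs of both the language
and its reverse are partially ordered. -/
def IsJTrivial {α : Type} (L : Language α) : Prop :=
  IsRTrivial L ∧ IsRTrivial L.reverse

/-- A *dead state*: a non-accepting state with a self-loop under every letter. -/
def DFA.DeadState {α σ : Type} (M : DFA α σ) (d : σ) : Prop :=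
  d ∉ M.accept ∧ ∀ a : α, M.step d a = d

namespace DFA

variable {α σ τ : Type}

/-- Two transition functions that are adjoint with respect to a relation recognise mutually
reversed languages. -/
theorem accepts_eq_reverse_of_adjoint (M : DFA α σ) (N : DFA α τ) (r : σ → τ → Prop)
    (hM : ∀ p, p ∈ M.accept ↔ r p N.start) (hN : ∀ i, i ∈ N.accept ↔ r M.start i)
    (hr : ∀ p a i, r (M.step p a) i ↔ r p (N.step i a)) :
    N.accepts = M.accepts.reverse := by
  have key : ∀ (w : List α) p i, r (M.evalFrom p w) i ↔ r p (N.evalFrom i w.reverse) := by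
    intro w
    induction w with
    | nil => intro p i; rfl
    | cons a w ih =>
      intro p i
      rw [evalFrom_cons, ih, hr, List.reverse_cons, evalFrom_append_singleton]
  ext w
  rw [Language.mem_reverse, mem_accepts, mem_accepts, hM, hN, eval, eval, key,
    List.reverse_reverse]

theorem stateComplexity_accepts_le [Finite σ] (M : DFA α σ) :
    stateComplexity M.accepts ≤ Nat.card σ :=
  Nat.sInf_le ⟨reindex (Finite.equivFin σ) M, accepts_reindex M _⟩

theorem MinimalDFA.card_le [Finite τ] {M : DFA α σ} (hM : M.MinimalDFA) (N : DFA α τ)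
    (h : N.accepts = M.accepts) : Nat.card σ ≤ Nat.card τ := by
  choose w hw using hM.1
  refine Nat.card_le_card_of_injective (fun q => N.eval (w q)) fun p q hpq => ?_
  by_contra hne
  obtain ⟨v, hv⟩ := hM.2 p q hne
  apply hv
  have key : ∀ q, M.evalFrom q v ∈ M.accept ↔ N.evalFrom (N.eval (w q)) v ∈ N.accept := by
    intro q
    have : w q ++ v ∈ N.accepts ↔ w q ++ v ∈ M.accepts := by rw [h]
    rw [mem_accepts, mem_accepts, eval, eval, evalFrom_of_append, evalFrom_of_append, hw] at this
    exact this.symm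
  rw [key p, key q]
  exact iff_of_eq (congrArg (fun x => N.evalFrom x v ∈ N.accept) hpq)

theorem MinimalDFA.stateComplexity_eq [Finite σ] {M : DFA α σ} (hM : M.MinimalDFA) :
    stateComplexity M.accepts = Nat.card σ := by
  refine le_antisymm (stateComplexity_accepts_le M)
    (le_csInf ⟨_, _, accepts_reindex M (Finite.equivFin σ)⟩ ?_)
  rintro k ⟨N, hN⟩
  simpa using hM.card_le N hN

/-- The set of states from which `w` leads to an accepting state. -/
def acceptingStates (M : DFA α σ) (w : List α) : Set σ := {p | M.evalFrom p w ∈ M.accept}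

theorem stateComplexity_reverse_le [Finite σ] (M : DFA α σ) :
    stateComplexity M.accepts.reverse ≤ (Set.range M.acceptingStates).ncard := by
  let N : DFA α (Set.range M.acceptingStates) :=
    { step := fun S a => ⟨{p | M.step p a ∈ S.1}, by
        obtain ⟨_, w, rfl⟩ := S
        exact ⟨a :: w, rfl⟩⟩
      start := ⟨M.accept, [], rfl⟩
      accept := {S | M.start ∈ S.1} }
  rw [← accepts_eq_reverse_of_adjoint M N (fun p S => p ∈ S.1) (fun _ => Iff.rfl)
    (fun _ => Iff.rfl) (fun _ _ _ => Iff.rfl)]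
  exact stateComplexity_accepts_le N

theorem evalFrom_replicate (M : DFA α σ) (p : σ) (a : α) (k : ℕ) :
    M.evalFrom p (List.replicate k a) = (fun q => M.step q a)^[k] p := by
  induction k generalizing p with
  | zero => rfl
  | succ k ih => rw [List.replicate_succ, evalFrom_cons, ih, Function.iterate_succ_apply]

theorem le_evalFrom [Preorder σ] {M : DFA α σ} (hM : ∀ p a, p ≤ M.step p a) (p : σ)
    (w : List α) : p ≤ M.evalFrom p w := by
  induction w generalizing p with
  | nil => exact le_rfl
  | cons a w ih => exact (hM p a).trans (ih _)

theorem partiallyOrderedDFA_of_le_step [PartialOrder σ] {M : DFA α σ}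
    (hM : ∀ p a, p ≤ M.step p a) : M.PartiallyOrderedDFA := by
  rintro p q ⟨v, hv⟩ ⟨w, hw⟩
  exact le_antisymm (hv ▸ le_evalFrom hM p v) (hw ▸ le_evalFrom hM q w)

/-- The reachability order of a partially ordered automaton. -/
abbrev PartiallyOrderedDFA.partialOrder {M : DFA α σ} (hM : M.PartiallyOrderedDFA) :
    PartialOrder σ where
  le p q := ∃ w : List α, M.evalFrom p w = q
  le_refl p := ⟨[], rfl⟩
  le_trans := by
    rintro p _ _ ⟨v, rfl⟩ ⟨w, rfl⟩
    exact ⟨v ++ w, M.evalFrom_of_append p v w⟩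
  le_antisymm := hM

end DFA

theorem Set.ncard_setOf_two_mem_iff_le {σ : Type*} [Finite σ] {s t : σ} (hst : s ≠ t)
    (P Q : Prop) : {S : Set σ | (s ∈ S ↔ P) ∧ (t ∈ S ↔ Q)}.ncard ≤ 2 ^ (Nat.card σ - 2) := by
  have hcard : (𝒫 ({s, t}ᶜ : Set σ)).ncard = 2 ^ (Nat.card σ - 2) := by
    rw [Set.ncard_powerset _ (Set.toFinite _), Set.ncard_compl, Set.ncard_pair hst]
  rw [← hcard]
  refine Set.ncard_le_ncard_of_injOn (fun S => S \ {s, t}) (fun S _ x hx => hx.2) ?_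
  rintro S ⟨hs, ht⟩ T ⟨hs', ht'⟩ h
  ext x
  by_cases hxs : x = s
  · subst hxs; rw [hs, hs']
  by_cases hxt : x = t
  · subst hxt; rw [ht, ht']
  have := Set.ext_iff.mp h x
  simpa [hxs, hxt] using this

/-- An inflationary map with two fixed points has height at most `card σ - 2`. -/
theorem isFixedPt_iterate_of_two_fixedPts {σ : Type*} [PartialOrder σ] [Finite σ] {f : σ → σ}
    (hf : ∀ p, p ≤ f p) {s t : σ} (hst : s ≠ t) (hs : f s = s) (ht : f t = t) (p : σ) :
    f (f^[Nat.card σ - 2] p) = f^[Nat.card σ - 2] p := by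
  by_contra hne
  set m := Nat.card σ - 2 with hm
  have hmono : Monotone fun i => f^[i] p := monotone_nat_of_le_succ fun i => by
    simpa only [Function.iterate_succ_apply'] using hf _
  have hnf : ∀ i ≤ m, f (f^[i] p) ≠ f^[i] p := by
    intro i hi hfix
    apply hne
    obtain ⟨j, hj⟩ := Nat.exists_eq_add_of_le' hi
    rw [hj, Function.iterate_add_apply, Function.iterate_fixed hfix, hfix]
  have hinj : Set.InjOn (fun i => f^[i] p) (Set.Iic m) := by
    have hlt : ∀ i j, i < j → i ≤ m → f^[i] p ≠ f^[j] p := by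
      intro i j hij hi h
      have h1 : f^[i + 1] p ≤ f^[j] p := hmono hij
      rw [Function.iterate_succ_apply', ← h] at h1
      exact hnf i hi (le_antisymm h1 (hf _))
    intro i hi j hj h
    rcases lt_trichotomy i j with hij | hij | hij
    · exact absurd h (hlt i j hij hi)
    · exact hij
    · exact absurd h.symm (hlt j i hij hj)
  have hle := Set.ncard_le_ncard_of_injOn (t := ({s, t}ᶜ : Set σ)) (fun i => f^[i] p)
    (fun i hi => by
      rintro (h | h)
      · exact hnf i hi (by rw [h, hs])
      · exact hnf i hi (by simp only [Set.mem_singleton_iff] at h; rw [h, ht])) hinj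
  rw [Set.ncard_compl, Set.ncard_pair hst, ← Finset.coe_Iic, Set.ncard_coe_finset,
    Nat.card_Iic] at hle
  omega

theorem DFA.PartiallyOrderedDFA.stateComplexity_reverse_le {σ : Type} [Finite σ]
    {M : DFA (Fin 2) σ} (hM : M.PartiallyOrderedDFA) (h2 : 2 ≤ Nat.card σ) :
    stateComplexity M.accepts.reverse ≤ 2 ^ (Nat.card σ - 2) + Nat.card σ - 1 := by
  refine M.stateComplexity_reverse_le.trans ?_
  let := hM.partialOrder
  have hstep : ∀ p a, p ≤ M.step p a := fun p a => ⟨[a], rfl⟩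
  have : Nontrivial σ := Finite.one_lt_card_iff_nontrivial.mp h2
  obtain ⟨t, ht⟩ := Set.finite_univ.exists_maximal (Set.univ_nonempty (α := σ))
  obtain ⟨s, hs⟩ := (Set.toFinite ({t}ᶜ : Set σ)).exists_maximal (exists_ne t)
  have hst : s ≠ t := hs.prop
  have htstep : ∀ a, M.step t a = t := fun a => (ht.eq_of_le trivial (hstep t a)).symm
  have hsstep : ∀ a, M.step s a = s ∨ M.step s a = t := fun a => by
    by_cases h : M.step s a = t
    · exact Or.inr h
    · exact Or.inl (hs.eq_of_le h (hstep s a)).symm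
  have heval : ∀ {p : σ}, (∀ a, M.step p a = p) → ∀ w, M.evalFrom p w = p := by
    intro p hp w
    induction w with
    | nil => rfl
    | cons a w ih => rw [DFA.evalFrom_cons, hp, ih]
  have hmem : ∀ {p q : σ} {w}, M.evalFrom p w = q → (p ∈ M.acceptingStates w ↔ q ∈ M.accept) :=
    fun h => by rw [← h]; exact Iff.rfl
  have hcount := Set.ncard_setOf_two_mem_iff_le hst
  by_cases hloop : ∀ a, M.step s a = s
  · have hsub : Set.range M.acceptingStates ⊆
        {S | (s ∈ S ↔ s ∈ M.accept) ∧ (t ∈ S ↔ t ∈ M.accept)} := by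
      rintro _ ⟨w, rfl⟩
      exact ⟨hmem (heval hloop w), hmem (heval htstep w)⟩
    have := (Set.ncard_le_ncard hsub).trans (hcount _ _)
    omega
  suffices h : ∃ B : Set (Set σ), B.ncard ≤ Nat.card σ - 1 ∧
      ∀ w, M.evalFrom s w = t ∨ M.acceptingStates w ∈ B by
    obtain ⟨B, hB, hw⟩ := h
    have hsub : Set.range M.acceptingStates ⊆
        {S | (s ∈ S ↔ t ∈ M.accept) ∧ (t ∈ S ↔ t ∈ M.accept)} ∪ B := by
      rintro _ ⟨w, rfl⟩
      exact (hw w).imp (fun h => ⟨hmem h, hmem (heval htstep w)⟩) id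
    have h1 := (Set.ncard_le_ncard hsub).trans (Set.ncard_union_le _ _)
    have h3 := hcount (t ∈ M.accept) (t ∈ M.accept)
    omega
  push Not at hloop
  obtain ⟨d, hd⟩ := hloop
  replace hd : M.step s d = t := (hsstep d).resolve_left hd
  by_cases hc : ∃ c, M.step s c = s
  · obtain ⟨c, hc⟩ := hc
    have hcd : ∀ a, a = c ∨ a = d := by
      have : c ≠ d := by rintro rfl; exact hst (hc.symm.trans hd)
      intro a
      omega
    have hword : ∀ w, M.evalFrom s w = t ∨ w = List.replicate w.length c := by
      intro w
      induction w with
      | nil => exact Or.inr rfl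
      | cons a w ih =>
        rw [DFA.evalFrom_cons]
        rcases hcd a with rfl | rfl
        · rw [hc]
          exact ih.imp id fun h => by rw [List.length_cons, List.replicate_succ, ← h]
        · rw [hd]
          exact Or.inl (heval htstep w)
    let f : σ → σ := fun q => M.step q c
    refine ⟨(fun k => {p | f^[k] p ∈ M.accept}) '' Set.Iio (Nat.card σ - 1), ?_, fun w => ?_⟩
    · refine (Set.ncard_image_le (Set.finite_Iio _)).trans_eq ?_
      rw [← Finset.coe_Iio, Set.ncard_coe_finset, Nat.card_Iio]
    · refine (hword w).imp id fun h => ?_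
      refine ⟨min w.length (Nat.card σ - 2), Set.mem_Iio.mpr (by omega), ?_⟩
      ext p
      have hev : M.evalFrom p w = f^[w.length] p := by
        conv_lhs => rw [h]
        exact M.evalFrom_replicate p c _
      have hmin : f^[min w.length (Nat.card σ - 2)] p = f^[w.length] p := by
        rcases le_total w.length (Nat.card σ - 2) with hle | hle
        · rw [min_eq_left hle]
        · obtain ⟨j, hj⟩ := Nat.exists_eq_add_of_le' hle
          rw [min_eq_right hle, hj, Function.iterate_add_apply]
          exact (Function.iterate_fixed (isFixedPt_iterate_of_two_fixedPts
            (fun q => hstep q c) hst hc (htstep c) p) j).symm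
      simp only [DFA.acceptingStates, Set.mem_ofPred_eq, hev, hmin]
  · push Not at hc
    refine ⟨{M.accept}, by rw [Set.ncard_singleton]; omega, fun w => ?_⟩
    cases w with
    | nil => exact Or.inr rfl
    | cons a w =>
      rw [DFA.evalFrom_cons, (hsstep a).resolve_left (hc a)]
      exact Or.inl (heval htstep w)

theorem DFA.exists_eval_eq_of_lt {α : Type} {k : ℕ} (M : DFA α (Fin (k + 1)))
    (h0 : M.start = 0) (h : ∀ q, q ≠ 0 → ∃ p < q, ∃ a, M.step p a = q) (q : Fin (k + 1)) :
    ∃ w, M.evalFrom M.start w = q := by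
  induction q using WellFoundedLT.induction with
  | ind q ih =>
    by_cases hq : q = 0
    · exact ⟨[], hq ▸ h0⟩
    obtain ⟨p, hpq, a, ha⟩ := h q hq
    obtain ⟨w, hw⟩ := ih p hpq
    exact ⟨w ++ [a], by rw [DFA.evalFrom_append_singleton, hw, ha]⟩

/-- The automaton with transitions `f` and start state `0` accepting in the states related
by `r` to `0`. -/
def relDFA {α : Type} {k m : ℕ} (f : Fin (k + 1) → α → Fin (k + 1))
    (r : Fin (k + 1) → Fin (m + 1) → Bool) : DFA α (Fin (k + 1)) where
  step := f
  start := 0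
  accept := {p | r p 0 = true}

/-- `f` is increasing, and every nonzero state is the image of a smaller state. -/
abbrev IsIncreasingGenerated {α : Type} {k : ℕ} (f : Fin (k + 1) → α → Fin (k + 1)) : Prop :=
  (∀ p a, p ≤ f p a) ∧ ∀ q, q ≠ 0 → ∃ p < q, ∃ a, f p a = q

section Adjoint

variable {α : Type} {k m : ℕ} {f : Fin (k + 1) → α → Fin (k + 1)}
  {g : Fin (m + 1) → α → Fin (m + 1)} {r : Fin (k + 1) → Fin (m + 1) → Bool}

theorem evalFrom_adjoint (hr : ∀ p a i, r (f p a) i = r p (g i a)) (w : List α)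
    (p : Fin (k + 1)) (i : Fin (m + 1)) :
    r ((relDFA f r).evalFrom p w) i =
      r p ((relDFA g (fun i p => r p i)).evalFrom i w.reverse) := by
  induction w generalizing p with
  | nil => rfl
  | cons a w ih =>
    rw [DFA.evalFrom_cons, ih, List.reverse_cons, DFA.evalFrom_append_singleton]
    exact hr _ _ _

theorem minimalDFA_relDFA (hr : ∀ p a i, r (f p a) i = r p (g i a))
    (hf : IsIncreasingGenerated f) (hg : IsIncreasingGenerated g)
    (hsep : ∀ p q, p ≠ q → ∃ i, r p i ≠ r q i) : (relDFA f r).MinimalDFA := by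
  refine ⟨DFA.exists_eval_eq_of_lt _ rfl hf.2, fun p q hpq => ?_⟩
  obtain ⟨i, hi⟩ := hsep p q hpq
  obtain ⟨w, rfl⟩ := (relDFA g fun i p => r p i).exists_eval_eq_of_lt rfl hg.2 i
  refine ⟨w.reverse, fun h => hi (Bool.eq_iff_iff.mpr ?_)⟩
  have key : ∀ p, (relDFA f r).evalFrom p w.reverse ∈ (relDFA f r).accept ↔
      r p ((relDFA g fun i p => r p i).evalFrom 0 w) = true := by
    intro p
    have := evalFrom_adjoint hr w.reverse p 0
    rw [List.reverse_reverse] at this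
    rw [← this]
    exact Iff.rfl
  exact (key p).symm.trans (h.trans (key q))

theorem exists_isJTrivial_of_adjoint (hr : ∀ p a i, r (f p a) i = r p (g i a))
    (hf : IsIncreasingGenerated f) (hg : IsIncreasingGenerated g)
    (hsep : ∀ p q, p ≠ q → ∃ i, r p i ≠ r q i) (hsep' : ∀ i j, i ≠ j → ∃ p, r p i ≠ r p j) :
    ∃ L : Language α, IsJTrivial L ∧ stateComplexity L = k + 1 ∧
      stateComplexity L.reverse = m + 1 := by
  have hM := minimalDFA_relDFA hr hf hg hsep
  have hN := minimalDFA_relDFA (r := fun i p => r p i) (fun p a i => (hr i a p).symm) hg hf hsep'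
  have hrev := DFA.accepts_eq_reverse_of_adjoint (relDFA f r) (relDFA g fun i p => r p i)
    (fun p i => r p i = true) (fun _ => Iff.rfl) (fun _ => Iff.rfl)
    (fun p a i => iff_of_eq (congrArg (· = true) (hr p a i)))
  refine ⟨(relDFA f r).accepts, ⟨⟨_, _, hM, rfl, DFA.partiallyOrderedDFA_of_le_step hf.1⟩,
    ⟨_, _, hN, hrev, DFA.partiallyOrderedDFA_of_le_step hg.1⟩⟩, ?_, ?_⟩
  · rw [hM.stateComplexity_eq, Nat.card_fin]
  · rw [← hrev, hN.stateComplexity_eq, Nat.card_fin]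

end Adjoint

theorem statement7 (n : ℕ) (h2 : 2 ≤ n) (h6 : n ≤ 6) :
    (∀ L : Language (Fin 2), IsRTrivial L → stateComplexity L = n →
      stateComplexity L.reverse ≤ 2 ^ (n - 2) + n - 1) ∧
    (∃ L : Language (Fin 2), IsJTrivial L ∧ stateComplexity L = n ∧
      stateComplexity L.reverse = 2 ^ (n - 2) + n - 1) := by
  constructor
  · rintro _ ⟨m, M, hmin, rfl, hpo⟩ hn
    rw [hmin.stateComplexity_eq] at hn
    subst hn
    exact hpo.stateComplexity_reverse_le h2
  · interval_cases n
    · refine exists_isJTrivial_of_adjoint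
        (f := ![![1, 0], ![1, 1]])
        (g := ![![1, 0], ![1, 1]])
        (r := fun p i => Nat.testBit (![1, 0] i) p)
        ?_ ?_ ?_ ?_ ?_ <;> decide +kernel
    · refine exists_isJTrivial_of_adjoint
        (f := ![![0, 1], ![2, 1], ![2, 2]])
        (g := ![![3, 1], ![2, 1], ![2, 3], ![3, 3]])
        (r := fun p i => Nat.testBit (![2, 3, 1, 0] i) p)
        ?_ ?_ ?_ ?_ ?_ <;> decide +kernel
    · refine exists_isJTrivial_of_adjoint
        (f := ![![0, 1], ![1, 2], ![3, 2], ![3, 3]])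
        (g := ![![6, 1], ![2, 3], ![2, 5], ![4, 3], ![4, 5], ![5, 6], ![6, 6]])
        (r := fun p i => Nat.testBit (![4, 6, 2, 7, 3, 1, 0] i) p)
        ?_ ?_ ?_ ?_ ?_ <;> decide +kernel
    · refine exists_isJTrivial_of_adjoint
        (f := ![![3, 1], ![1, 2], ![2, 3], ![4, 3], ![4, 4]])
        (g := ![![10, 1], ![2, 3], ![4, 9], ![6, 5], ![4, 9], ![6, 5], ![7, 8], ![7, 8], ![9, 10],
            ![9, 10], ![11, 11], ![11, 11]])
        (r := fun p i => Nat.testBit (![8, 12, 5, 14, 4, 15, 7, 6, 3, 2, 1, 0] i) p)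
        ?_ ?_ ?_ ?_ ?_ <;> decide +kernel
    · refine exists_isJTrivial_of_adjoint
        (f := ![![0, 1], ![1, 2], ![4, 3], ![3, 4], ![5, 4], ![5, 5]])
        (g := ![![8, 1], ![2, 3], ![4, 8], ![5, 6], ![4, 11], ![7, 8], ![9, 10], ![7, 11],
            ![18, 17], ![12, 15], ![13, 10], ![20, 18], ![12, 16], ![14, 15], ![14, 16],
            ![17, 17], ![19, 18], ![17, 19], ![18, 19], ![19, 20], ![20, 20]])
        (r := fun p i => Nat.testBit (![18, 25, 13, 28, 9, 12, 30, 8, 6, 14, 31, 4, 10, 15, 11, 7,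
            5, 3, 2, 1, 0] i) p)
        ?_ ?_ ?_ ?_ ?_ <;> decide +kernel
end

section
/- Every R-trivial regular language L (over any finite alphabet) with sc(L) = n, where n ≥ 1, satisfies sc(L^R) ≤ 2^{n-1}. -/
/-- A finite nonempty partially ordered DFA has a state fixed by every letter. -/
theorem DFA.PartiallyOrderedDFA.exists_forall_step_eq {α σ : Type} [Finite σ] [Nonempty σ]
    {M : DFA α σ} (hM : M.PartiallyOrderedDFA) : ∃ d : σ, ∀ a : α, M.step d a = d := by
  let _ : PartialOrder σ :=
    { le := fun p q => ∃ w : List α, M.evalFrom p w = q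
      le_refl := fun p => ⟨[], rfl⟩
      le_trans := by
        rintro p q r ⟨v, rfl⟩ ⟨w, rfl⟩
        exact ⟨v ++ w, M.evalFrom_of_append p v w⟩
      le_antisymm := hM }
  obtain ⟨d, -, hd⟩ := (Set.toFinite (Set.univ : Set σ)).exists_maximal Set.univ_nonempty
  have step_ge (a : α) : d ≤ M.step d a := ⟨[a], rfl⟩
  exact ⟨d, fun a => le_antisymm (hd (Set.mem_univ _) (step_ge a)) (step_ge a)⟩

/-- A minimal DFA has at most as many states as any finite DFA accepting the same language. -/
theorem DFA.MinimalDFA.card_le_s9 {α σ τ : Type} [Fintype σ] [Fintype τ] {M : DFA α σ}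
    (hM : M.MinimalDFA) {N : DFA α τ} (h : N.accepts = M.accepts) :
    Fintype.card σ ≤ Fintype.card τ := by
  choose w hw using hM.1
  refine Fintype.card_le_of_injective (fun q => N.eval (w q)) fun p q hpq => ?_
  by_contra hne
  obtain ⟨v, hv⟩ := hM.2 p q hne
  have accepts_iff (r : σ) :
      M.evalFrom r v ∈ M.accept ↔ N.evalFrom (N.eval (w r)) v ∈ N.accept := by
    rw [← DFA.mem_acceptsFrom, ← DFA.mem_acceptsFrom, ← Language.leftQuotient_accepts_apply, h,
      Language.leftQuotient_accepts_apply, DFA.eval, hw]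
  exact hv (by rw [accepts_iff, accepts_iff, show N.eval (w p) = N.eval (w q) from hpq])

theorem stateComplexity_le_card {α σ : Type} [Fintype σ] (M : DFA α σ) :
    stateComplexity M.accepts ≤ Fintype.card σ :=
  Nat.sInf_le ⟨DFA.reindex (Fintype.equivFin σ) M, DFA.accepts_reindex M _⟩

/-- The deterministic automaton for the reverse of the language of `M`, restricted to the sets of
states that agree with the accepting set on a state `d` fixed by every letter. -/
def DFA.reverseOfSink {α σ : Type} (M : DFA α σ) (d : σ) (hd : ∀ a : α, M.step d a = d) :
    DFA α {S : Set σ // d ∈ S ↔ d ∈ M.accept} where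
  step S a := ⟨{q | M.step q a ∈ S.1}, by
    change M.step d a ∈ S.1 ↔ _
    rw [hd]
    exact S.2⟩
  start := ⟨M.accept, Iff.rfl⟩
  accept := {S | M.start ∈ S.1}

theorem DFA.mem_eval_reverseOfSink {α σ : Type} (M : DFA α σ) (d : σ)
    (hd : ∀ a : α, M.step d a = d) (w : List α) (q : σ) :
    q ∈ ((M.reverseOfSink d hd).eval w).1 ↔ M.evalFrom q w.reverse ∈ M.accept := by
  induction w using List.reverseRecOn generalizing q with
  | nil => rfl
  | append_singleton w a ih =>
    rw [DFA.eval_append_singleton, List.reverse_append, List.reverse_singleton,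
      List.singleton_append, DFA.evalFrom_cons, ← ih]
    rfl

theorem DFA.accepts_reverseOfSink {α σ : Type} (M : DFA α σ) (d : σ)
    (hd : ∀ a : α, M.step d a = d) : (M.reverseOfSink d hd).accepts = M.accepts.reverse := by
  ext w
  exact M.mem_eval_reverseOfSink d hd w M.start

/-- Subsets of a finite type with prescribed membership of one element. -/
theorem Fintype.card_subtype_mem_iff_le {σ : Type} [Fintype σ] (d : σ) (P : Prop)
    [Fintype {S : Set σ // d ∈ S ↔ P}] :
    Fintype.card {S : Set σ // d ∈ S ↔ P} ≤ 2 ^ (Fintype.card σ - 1) := by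
  classical
  have card_ne : Fintype.card {q : σ // q ≠ d} = Fintype.card σ - 1 := by
    simp [Fintype.card_subtype_compl]
  rw [← card_ne, ← Fintype.card_set]
  refine Fintype.card_le_of_injective (fun S => {q : {q : σ // q ≠ d} | q.1 ∈ S.1}) ?_
  intro S T hST
  ext q
  by_cases hq : q = d
  · rw [hq, S.2, T.2]
  · exact Set.ext_iff.mp hST ⟨q, hq⟩

theorem statement9 {α : Type} [Fintype α] (L : Language α) (n : ℕ) (hn : 1 ≤ n)
    (hR : IsRTrivial L) (hsc : stateComplexity L = n) :
    stateComplexity L.reverse ≤ 2 ^ (n - 1) := by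
  classical
  obtain ⟨m, M, hmin, rfl, hpo⟩ := hR
  obtain ⟨N, hN⟩ : n ∈ {k : ℕ | ∃ N : DFA α (Fin k), N.accepts = M.accepts} :=
    hsc ▸ Nat.sInf_mem ⟨m, M, rfl⟩
  have hmn : Fintype.card (Fin m) ≤ Fintype.card (Fin n) := hmin.card_le_s9 hN
  have : Nonempty (Fin m) := ⟨M.start⟩
  obtain ⟨d, hd⟩ := hpo.exists_forall_step_eq
  calc stateComplexity M.accepts.reverse
      ≤ Fintype.card {S : Set (Fin m) // d ∈ S ↔ d ∈ M.accept} := by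
        rw [← M.accepts_reverseOfSink d hd]
        exact stateComplexity_le_card _
    _ ≤ 2 ^ (Fintype.card (Fin m) - 1) := Fintype.card_subtype_mem_iff_le _ _
    _ ≤ 2 ^ (n - 1) := Nat.pow_le_pow_right two_pos (by simpa using Nat.sub_le_sub_right hmn 1)
end
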